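/- Chaitin's halting probability Ω is not a computable real number. -/

import Mathlib

/-- A real number is computable if a computable sequence of rationals
approximates it with error `< 2 ^ (-n)`. -/
def IsComputableReal (x : ℝ) : Prop :=
  ∃ f : ℕ → ℚ, Computable f ∧ ∀ n : ℕ, |x - (f n : ℝ)| < (2 : ℝ) ^ (-(n : ℤ))
/-- A partial machine on binary strings has prefix-free domain. -/
def PrefixFreeDom (M : List Bool →. List Bool) : Prop :=
  ∀ p q : List Bool, (M p).Dom → (M q).Dom → p <+: q → p = q

/-- `M` is a universal prefix-free machine: it simulates every partial
recursive prefix-free machine via a fixed prefix. -/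
def UniversalPF (M : List Bool →. List Bool) : Prop :=
  ∀ N : List Bool →. List Bool, Partrec N → PrefixFreeDom N →
    ∃ w : List Bool, ∀ p : List Bool, M (w ++ p) = N p

/-- Chaitin's halting probability of a machine `M`. -/
noncomputable def chaitinOmega (M : List Bool →. List Bool) : ℝ :=
  ∑' p : {p : List Bool // (M p).Dom}, (2 : ℝ) ^ (-(p.val.length : ℤ))

theorem exists_computable_find {α : Type} [Primcodable α] {p : α → ℕ → Bool}
    (hp : Computable₂ p) (h : ∀ a, ∃ n, p a n = true) :
    ∃ g : α → ℕ, Computable g ∧ ∀ a, p a (g a) = true ∧ ∀ m < g a, p a m = false := by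
  have h1 : Partrec fun a => Nat.rfind (fun n => (Part.some (p a n) : Part Bool)) :=
    Partrec.rfind hp.partrec₂
  refine ⟨fun a => Nat.find (h a), h1.of_eq fun a => ?_, fun a => ⟨Nat.find_spec (h a), fun m hm => ?_⟩⟩
  · refine Part.eq_some_iff.2 (Nat.mem_rfind.2 ?_)
    refine ⟨?_, fun {m} hm => ?_⟩
    · simpa using (Nat.find_spec (h a)).symm
    · have := Nat.find_min (h a) hm
      simpa using this
  · have := Nat.find_min (h a) hm
    simpa using this

/-- The encoding of rationals underlying the `Denumerable` instance. -/
def oldEnc : ℚ → ℕ := @Encodable.encode ℚ Rat.instEncodable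

theorem oldEnc_eq (q : ℚ) : oldEnc q = Nat.pair (Encodable.encode q.num) q.den := rfl

theorem oldEnc_ofNat : ∃ (_ : DecidablePred (· ∈ Set.range oldEnc))
    (_ : Infinite (Set.range oldEnc)),
    ∀ k, oldEnc (Denumerable.ofNat ℚ k) = (Nat.Subtype.ofNat (Set.range oldEnc) k).1 := by
  let i1 : DecidablePred (· ∈ Set.range oldEnc) := @Encodable.decidableRangeEncode ℚ Rat.instEncodable
  have i2 : Infinite (Set.range oldEnc) :=
    Infinite.of_injective _
      (Equiv.ofInjective _ (@Encodable.encode_injective ℚ Rat.instEncodable)).injective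
  refine ⟨i1, i2, fun k => ?_⟩
  exact congrArg Subtype.val ((@Encodable.equivRangeEncode ℚ Rat.instEncodable).apply_symm_apply
    (Nat.Subtype.ofNat (Set.range oldEnc) k))

theorem encode_ofNat_int (n : ℕ) : Encodable.encode (Int.ofNat n) = 2 * n := by
  show Nat.bit false n = _
  simp

theorem encode_negSucc_int (n : ℕ) : Encodable.encode (Int.negSucc n) = 2 * n + 1 := by
  show Nat.bit true n = _
  simp

theorem toNat_eq_code (z : ℤ) :
    z.toNat = if (Encodable.encode z) % 2 = 0 then (Encodable.encode z) / 2 else 0 := by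
  cases z with
  | ofNat n => rw [encode_ofNat_int]; simp
  | negSucc n => rw [encode_negSucc_int]; simp

theorem natAbs_eq_code (z : ℤ) : z.natAbs = (Encodable.encode z + 1) / 2 := by
  cases z with
  | ofNat n => rw [encode_ofNat_int]; simp; omega
  | negSucc n => rw [encode_negSucc_int]; simp; omega

theorem mem_range_oldEnc (m : ℕ) : m ∈ Set.range oldEnc ↔
    (0 < m.unpair.2 ∧ ∀ d < m.unpair.2 + 1, (d = 1 ∨ ¬ (((m.unpair.1 + 1) / 2) % d = 0) ∨
      ¬ (m.unpair.2 % d = 0))) := by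
  have key : ∀ x b : ℕ, 0 < b → ((∀ d < b + 1, (d = 1 ∨ ¬ (x % d = 0) ∨ ¬ (b % d = 0))) ↔
      Nat.Coprime x b) := by
    intro x b hb
    constructor
    · intro h
      have h1 := h (Nat.gcd x b) (Nat.lt_succ_of_le (Nat.gcd_le_right _ hb))
      have h2 := Nat.mod_eq_zero_of_dvd (Nat.gcd_dvd_left x b)
      have h3 := Nat.mod_eq_zero_of_dvd (Nat.gcd_dvd_right x b)
      rcases h1 with h1 | h1 | h1
      · exact h1
      · exact absurd h2 h1
      · exact absurd h3 h1
    · intro h d _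
      by_contra! hc
      exact hc.1 (Nat.eq_one_of_dvd_coprimes h (Nat.dvd_of_mod_eq_zero hc.2.1)
        (Nat.dvd_of_mod_eq_zero hc.2.2))
  constructor
  · rintro ⟨q, rfl⟩
    rw [oldEnc_eq]
    simp only [Nat.unpair_pair]
    refine ⟨q.den_pos, ?_⟩
    rw [← natAbs_eq_code, key _ _ q.den_pos]
    exact q.reduced
  · rintro ⟨h1, h2⟩
    rw [key _ _ h1] at h2
    obtain ⟨z, hz⟩ : ∃ z : ℤ, Encodable.encode z = m.unpair.1 :=
      ⟨Denumerable.ofNat ℤ _, Denumerable.encode_ofNat _⟩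
    rw [← hz, ← natAbs_eq_code] at h2
    refine ⟨⟨z, m.unpair.2, h1.ne', h2⟩, ?_⟩
    rw [oldEnc_eq]
    simp only [hz, Nat.pair_unpair]

theorem primrecPred_oldEnc : PrimrecPred fun m => m ∈ Set.range oldEnc := by
  have hR : PrimrecRel fun (d m : ℕ) => (d = 1 ∨ ¬ (((m.unpair.1 + 1) / 2) % d = 0) ∨
      ¬ (m.unpair.2 % d = 0)) := by
    have h1 : Primrec fun x : ℕ × ℕ => x.2.unpair.1 :=
      Primrec.fst.comp (Primrec.unpair.comp Primrec.snd)
    have h2 : Primrec fun x : ℕ × ℕ => x.2.unpair.2 :=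
      Primrec.snd.comp (Primrec.unpair.comp Primrec.snd)
    have a1 : PrimrecPred fun x : ℕ × ℕ => x.1 = 1 :=
      Primrec.eq.comp Primrec.fst (Primrec.const 1)
    have a2 : PrimrecPred fun x : ℕ × ℕ => ((x.2.unpair.1 + 1) / 2) % x.1 = 0 :=
      Primrec.eq.comp (Primrec.nat_mod.comp
        (Primrec.nat_div.comp (Primrec.succ.comp h1) (Primrec.const 2)) Primrec.fst)
        (Primrec.const 0)
    have a3 : PrimrecPred fun x : ℕ × ℕ => x.2.unpair.2 % x.1 = 0 :=
      Primrec.eq.comp (Primrec.nat_mod.comp h2 Primrec.fst) (Primrec.const 0)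
    exact a1.or (a2.not.or a3.not)
  have h2 : Primrec fun x : ℕ => x.unpair.2 := Primrec.snd.comp Primrec.unpair
  have hB := hR.forall_lt.comp (Primrec.succ.comp h2) Primrec.id
  have hA : PrimrecPred fun m : ℕ => 0 < m.unpair.2 :=
    Primrec.nat_lt.comp (Primrec.const 0) h2
  exact (hA.and hB).of_eq fun m => (mem_range_oldEnc m).symm

theorem exists_computable_oldEnc :
    ∃ g : ℕ → ℕ, Computable g ∧ ∀ k, g k = oldEnc (Denumerable.ofNat ℚ k) := by
  obtain ⟨i1, i2, hk⟩ := oldEnc_ofNat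
  have hdec : Primrec fun m => decide (m ∈ Set.range oldEnc) := by
    obtain ⟨_, h⟩ := primrecPred_oldEnc
    convert h
  have hp : Computable₂ fun (y m : ℕ) => decide (y + m + 1 ∈ Set.range oldEnc) || decide (y ∉ Set.range oldEnc) := by
    refine Primrec.to_comp (Primrec.or.comp ?_ ?_)
    · exact hdec.comp (Primrec.succ.comp (Primrec.nat_add.comp Primrec.fst Primrec.snd))
    · have := Primrec.not.comp (hdec.comp (Primrec.fst (α := ℕ) (β := ℕ)))
      refine this.of_eq fun a => ?_
      simp
  obtain ⟨g, hg, hg'⟩ := exists_computable_find hp (fun y => by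
    by_cases hy : y ∈ Set.range oldEnc
    · obtain ⟨m, hm⟩ := Nat.Subtype.exists_succ (⟨y, hy⟩ : Set.range oldEnc)
      refine ⟨m, ?_⟩
      simp only [Bool.or_eq_true, decide_eq_true_eq]
      exact Or.inl hm
    · exact ⟨0, by simp only [Bool.or_eq_true, decide_eq_true_eq]; exact Or.inr hy⟩)
  have hs : ∀ x : Set.range oldEnc, (Nat.Subtype.succ x).1 = x.1 + g x.1 + 1 := by
    intro x
    show x.1 + Nat.find (Nat.Subtype.exists_succ x) + 1 = _
    congr 2
    rw [Nat.find_eq_iff]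
    obtain ⟨h1, h2⟩ := hg' x.1
    simp only [Bool.or_eq_true, decide_eq_true_eq, Bool.or_eq_false_iff, decide_eq_false_iff_not] at h1 h2
    exact ⟨h1.resolve_right (fun h => h x.2), fun n hn => (h2 n hn).1⟩
  refine ⟨fun k => Nat.rec (Nat.Subtype.ofNat (Set.range oldEnc) 0).1
    (fun _ y => y + g y + 1) k, ?_, fun k => ?_⟩
  · refine Computable.nat_rec (f := fun k => k) (h := fun _ x => x.2 + g x.2 + 1)
      Computable.id (Computable.const _) ?_
    have h2 : Computable fun x : ℕ × ℕ × ℕ => x.2.2 := Computable.snd.comp Computable.snd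
    exact Computable.succ.comp (Primrec.nat_add.to_comp.comp h2 (hg.comp h2))
  · rw [hk]
    induction k with
    | zero => rfl
    | succ k ih =>
      show _ = (Nat.Subtype.succ _).1
      rw [hs, ← ih]

theorem computable_num_den {f : ℕ → ℚ} (hf : Computable f) :
    Computable (fun n => (f n).num.toNat) ∧ Computable (fun n => (f n).den) := by
  obtain ⟨g, hg, hg'⟩ := exists_computable_oldEnc
  have h1 : Computable fun n => g (@Encodable.encode ℚ Rat.instDenumerable.toEncodable (f n)) := hg.comp (Computable.encode.comp hf)
  have h2 : ∀ n, g (@Encodable.encode ℚ Rat.instDenumerable.toEncodable (f n)) =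
      Nat.pair (Encodable.encode (f n).num) (f n).den := by
    intro n
    rw [hg', ← oldEnc_eq]
    congr 1
    exact Denumerable.ofNat_encode (f n)
  have h3 : Computable fun n => (g (@Encodable.encode ℚ Rat.instDenumerable.toEncodable (f n))).unpair := Computable.unpair.comp h1
  constructor
  · have h4 : Primrec fun a : ℕ => if a % 2 = 0 then a / 2 else 0 :=
      Primrec.ite (Primrec.eq.comp (Primrec.nat_mod.comp Primrec.id (Primrec.const 2))
        (Primrec.const 0)) (Primrec.nat_div.comp Primrec.id (Primrec.const 2)) (Primrec.const 0)
    refine (h4.to_comp.comp (Computable.fst.comp h3)).of_eq fun n => ?_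
    rw [toNat_eq_code, h2, Nat.unpair_pair]
  · refine (Computable.snd.comp h3).of_eq fun n => ?_
    rw [h2, Nat.unpair_pair]

open Nat.Partrec in
theorem exists_halting_code (M : List Bool →. List Bool) (hM : Partrec M) :
    ∃ c : Code, ∀ p : List Bool, (c.eval (Encodable.encode p)).Dom ↔ (M p).Dom := by
  obtain ⟨c, hc⟩ := Code.exists_code.1 hM
  refine ⟨c, fun p => ?_⟩
  rw [hc]
  simp

theorem primrec_two_pow : Primrec fun n : ℕ => 2 ^ n := by
  have : Primrec fun n : ℕ => (Nat.rec 1 (fun _ y => y * 2) n : ℕ) :=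
    Primrec.nat_rec₁ 1 (Primrec.nat_mul.comp Primrec.snd (Primrec.const 2))
  refine this.of_eq fun n => ?_
  induction n with
  | zero => rfl
  | succ n ih => simp only [pow_succ, ← ih]

/-- Whether string `p` is seen to halt by stage `s`. -/
def seen (c : Nat.Partrec.Code) (s : ℕ) (p : List Bool) : Bool :=
  decide (Encodable.encode p < s) && (c.evaln s (Encodable.encode p)).isSome

/-- Contribution of the index `i` to the stage `s` sum. -/
def stageTerm (c : Nat.Partrec.Code) (s i : ℕ) : ℕ :=
  ((Encodable.decode i : Option (List Bool)).map fun p =>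
    if Encodable.encode p = i ∧ seen c s p = true then 2 ^ (s - p.length) else 0).getD 0

/-- The stage `s` sum, scaled by `2 ^ s`. -/
def stageSum (c : Nat.Partrec.Code) (s : ℕ) : ℕ :=
  Nat.rec 0 (fun i acc => acc + stageTerm c s i) s

theorem primrec_seen (c : Nat.Partrec.Code) : Primrec₂ (seen c) := by
  have h1 : Primrec fun x : ℕ × List Bool => Encodable.encode x.2 :=
    Primrec.encode.comp Primrec.snd
  refine Primrec.and.comp ?_ ?_
  · exact (Primrec.nat_lt.comp h1 Primrec.fst).decide
  · refine Primrec.option_isSome.comp ?_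
    exact Nat.Partrec.Code.primrec_evaln.comp
      (((Primrec.fst.pair (Primrec.const c))).pair h1)

theorem primrec_stageTerm (c : Nat.Partrec.Code) : Primrec₂ (stageTerm c) := by
  refine Primrec.option_getD.comp ?_ (Primrec.const 0)
  refine Primrec.option_map (Primrec.decode.comp Primrec.snd) ?_
  have hs : Primrec fun x : (ℕ × ℕ) × List Bool => x.1.1 := Primrec.fst.comp Primrec.fst
  have hi : Primrec fun x : (ℕ × ℕ) × List Bool => x.1.2 := Primrec.snd.comp Primrec.fst
  have hp : Primrec fun x : (ℕ × ℕ) × List Bool => x.2 := Primrec.snd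
  refine Primrec.ite (PrimrecPred.and ?_ ?_) ?_ (Primrec.const 0)
  · exact Primrec.eq.comp (Primrec.encode.comp hp) hi
  · exact Primrec.eq.comp ((primrec_seen c).comp hs hp) (Primrec.const true)
  · exact primrec_two_pow.comp (Primrec.nat_sub.comp hs (Primrec.list_length.comp hp))

theorem primrec_stageSum (c : Nat.Partrec.Code) : Primrec (stageSum c) := by
  refine Primrec.nat_rec' (f := fun s => s) (h := fun s x => x.2 + stageTerm c s x.1)
    Primrec.id (Primrec.const 0) ?_
  refine Primrec.nat_add.comp (Primrec.snd.comp Primrec.snd) ?_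
  exact (primrec_stageTerm c).comp Primrec.fst (Primrec.fst.comp Primrec.snd)

theorem stageSum_eq_sum (c : Nat.Partrec.Code) (s : ℕ) :
    stageSum c s = ∑ i ∈ Finset.range s, stageTerm c s i := by
  have : ∀ k, (Nat.rec 0 (fun i acc => acc + stageTerm c s i) k : ℕ) =
      ∑ i ∈ Finset.range k, stageTerm c s i := by
    intro k
    induction k with
    | zero => rfl
    | succ k ih => rw [Finset.sum_range_succ, ← ih]
  exact this s

theorem length_le_encode (p : List Bool) : p.length ≤ Encodable.encode p := by
  induction p with
  | nil => simp
  | cons a l ih =>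
    rw [Encodable.encode_list_cons, List.length_cons]
    have := Nat.right_le_pair (Encodable.encode a) (Encodable.encode l)
    omega

theorem finite_seen (c : Nat.Partrec.Code) (s : ℕ) : {p | seen c s p = true}.Finite := by
  refine Set.Finite.of_finite_image (f := Encodable.encode) ((Set.finite_lt_nat s).subset ?_)
    (Encodable.encode_injective.injOn)
  rintro _ ⟨p, hp, rfl⟩
  simp only [seen, Set.mem_ofPred_eq, Bool.and_eq_true, decide_eq_true_eq] at hp
  exact hp.1

/-- The finite set of strings seen to halt by stage `s`. -/
noncomputable def seenSet (c : Nat.Partrec.Code) (s : ℕ) : Finset (List Bool) :=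
  (finite_seen c s).toFinset

theorem mem_seenSet {c : Nat.Partrec.Code} {s : ℕ} {p : List Bool} :
    p ∈ seenSet c s ↔ seen c s p = true := by simp [seenSet]

theorem seen_lt {c : Nat.Partrec.Code} {s : ℕ} {p : List Bool} (h : seen c s p = true) :
    Encodable.encode p < s := by
  simp only [seen, Bool.and_eq_true, decide_eq_true_eq] at h
  exact h.1

theorem seen_dom {c : Nat.Partrec.Code} {s : ℕ} {p : List Bool} (h : seen c s p = true) :
    (c.eval (Encodable.encode p)).Dom := by
  simp only [seen, Bool.and_eq_true, decide_eq_true_eq] at h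
  obtain ⟨y, hy⟩ := Option.isSome_iff_exists.1 h.2
  exact Part.dom_iff_mem.2 ⟨y, Nat.Partrec.Code.evaln_sound hy⟩

theorem seen_mono {c : Nat.Partrec.Code} {s t : ℕ} (hst : s ≤ t) {p : List Bool}
    (h : seen c s p = true) : seen c t p = true := by
  simp only [seen, Bool.and_eq_true, decide_eq_true_eq] at h ⊢
  obtain ⟨y, hy⟩ := Option.isSome_iff_exists.1 h.2
  exact ⟨h.1.trans_le hst,
    Option.isSome_iff_exists.2 ⟨y, Nat.Partrec.Code.evaln_mono hst hy⟩⟩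

theorem exists_seen {c : Nat.Partrec.Code} {p : List Bool}
    (h : (c.eval (Encodable.encode p)).Dom) : ∃ s, seen c s p = true := by
  obtain ⟨y, hy⟩ := Part.dom_iff_mem.1 h
  obtain ⟨k, hk⟩ := Nat.Partrec.Code.evaln_complete.1 hy
  refine ⟨max k (Encodable.encode p + 1), ?_⟩
  simp only [seen, Bool.and_eq_true, decide_eq_true_eq]
  exact ⟨by omega, Option.isSome_iff_exists.2
    ⟨y, Nat.Partrec.Code.evaln_mono (le_max_left _ _) hk⟩⟩

theorem stageSum_eq (c : Nat.Partrec.Code) (s : ℕ) :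
    (stageSum c s : ℝ) / 2 ^ s = ∑ p ∈ seenSet c s, (2 : ℝ) ^ (-(p.length : ℤ)) := by
  have h1 : stageSum c s = ∑ p ∈ seenSet c s, 2 ^ (s - p.length) := by
    rw [stageSum_eq_sum]
    have hsub : (seenSet c s).image Encodable.encode ⊆ Finset.range s := by
      intro i hi
      obtain ⟨p, hp, rfl⟩ := Finset.mem_image.1 hi
      exact Finset.mem_range.2 (seen_lt (mem_seenSet.1 hp))
    rw [← Finset.sum_subset hsub, Finset.sum_image Encodable.encode_injective.injOn]
    · refine Finset.sum_congr rfl fun p hp => ?_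
      simp [stageTerm, mem_seenSet.1 hp]
    · intro i _ hi
      rw [stageTerm]
      rcases hd : (Encodable.decode i : Option (List Bool)) with _ | p
      · rfl
      · simp only [Option.map_some, Option.getD_some]
        rw [if_neg]
        rintro ⟨h1, h2⟩
        exact hi (Finset.mem_image.2 ⟨p, mem_seenSet.2 h2, h1⟩)
  rw [h1, Nat.cast_sum, Finset.sum_div]
  refine Finset.sum_congr rfl fun p hp => ?_
  have hl : p.length ≤ s := (length_le_encode p).trans (seen_lt (mem_seenSet.1 hp)).le
  rw [zpow_neg, zpow_natCast]
  push_cast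
  rw [pow_sub₀ _ two_ne_zero hl]
  field_simp

theorem kraft_prefixFree (S : Finset (List Bool))
    (h : ∀ p ∈ S, ∀ q ∈ S, p <+: q → p = q) :
    ∑ p ∈ S, (2 : ℝ) ^ (-(p.length : ℤ)) ≤ 1 := by
  by_cases h0 : [] ∈ S
  · have : S = {[]} := by
      ext q
      rw [Finset.mem_singleton]
      exact ⟨fun hq => (h [] h0 q hq List.nil_prefix).symm, fun hq => hq ▸ h0⟩
    rw [this]
    simp
  · have hud : InformationTheory.UniquelyDecodable (S : Set (List Bool)) := by
      intro L₁
      induction L₁ with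
      | nil =>
        intro L₂ _ h2 he
        cases L₂ with
        | nil => rfl
        | cons b t =>
          have hb : b = [] := by
            have := he.symm
            simp only [List.flatten_nil, List.flatten_cons, List.append_eq_nil_iff] at this
            exact this.1
          exact absurd (hb ▸ h2 b (by simp)) h0
      | cons a l ih =>
        intro L₂ h1 h2 he
        cases L₂ with
        | nil =>
          have hb : a = [] := by
            simp only [List.flatten_nil, List.flatten_cons, List.append_eq_nil_iff] at he
            exact he.1
          exact absurd (hb ▸ h1 a (by simp)) h0
        | cons b t =>
          simp only [List.flatten_cons] at he
          have ha := h1 a (by simp)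
          have hb := h2 b (by simp)
          have hab : a = b := by
            rcases List.prefix_or_prefix_of_prefix (List.prefix_append a l.flatten)
              (he ▸ List.prefix_append b t.flatten) with hp | hp
            · exact h a ha b hb hp
            · exact (h b hb a ha hp).symm
          subst hab
          rw [ih t (fun w hw => h1 w (by simp [hw])) (fun w hw => h2 w (by simp [hw]))
            (List.append_cancel_left he)]
    have := InformationTheory.kraft_mcmillan_inequality hud
    refine le_trans (le_of_eq (Finset.sum_congr rfl fun p _ => ?_)) this
    simp [zpow_neg]

theorem summable_omega (M : List Bool →. List Bool) (hpf : PrefixFreeDom M) :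
    Summable fun p : {p : List Bool // (M p).Dom} => (2 : ℝ) ^ (-(p.val.length : ℤ)) := by
  refine summable_of_sum_le (c := 1) (fun p => by positivity) fun u => ?_
  have := kraft_prefixFree (u.map (Function.Embedding.subtype _)) (by
    intro p hp q hq hpq
    simp only [Finset.mem_map, Function.Embedding.subtype_apply] at hp hq
    obtain ⟨p, _, rfl⟩ := hp
    obtain ⟨q, _, rfl⟩ := hq
    exact hpf _ _ p.2 q.2 hpq)
  rwa [Finset.sum_map] at this

theorem sum_le_omega {M : List Bool →. List Bool} (hpf : PrefixFreeDom M)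
    (F : Finset (List Bool)) (hF : ∀ p ∈ F, (M p).Dom) :
    ∑ p ∈ F, (2 : ℝ) ^ (-(p.length : ℤ)) ≤ chaitinOmega M := by
  classical
  have := (summable_omega M hpf).sum_le_tsum (F.subtype _) (fun p _ => by positivity)
  rwa [Finset.sum_subtype_of_mem (fun p : List Bool => (2 : ℝ) ^ (-(p.length : ℤ))) hF] at this

theorem exists_stage_gt {M : List Bool →. List Bool} (hpf : PrefixFreeDom M)
    {c : Nat.Partrec.Code}
    (hc : ∀ p : List Bool, (c.eval (Encodable.encode p)).Dom ↔ (M p).Dom)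
    {r : ℝ} (hr : r < chaitinOmega M) :
    ∃ s, r < ∑ p ∈ seenSet c s, (2 : ℝ) ^ (-(p.length : ℤ)) := by
  obtain ⟨T, hT⟩ := ((summable_omega M hpf).hasSum.eventually_const_lt hr).exists
  have : ∃ s, ∀ p ∈ T, seen c s p.1 = true := by
    choose st hst using fun p : {p : List Bool // (M p).Dom} => exists_seen ((hc p.1).2 p.2)
    exact ⟨T.sup st, fun p hp => seen_mono (Finset.le_sup hp) (hst p)⟩
  obtain ⟨s, hs⟩ := this
  refine ⟨s, hT.trans_le ?_⟩
  have h := Finset.sum_map T (Function.Embedding.subtype _)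
    (fun p : List Bool => (2 : ℝ) ^ (-(p.length : ℤ)))
  refine le_trans (le_of_eq h.symm) ?_
  refine Finset.sum_le_sum_of_subset_of_nonneg ?_ (fun _ _ _ => by positivity)
  intro p hp
  simp only [Finset.mem_map, Function.Embedding.subtype_apply] at hp
  obtain ⟨p, hp, rfl⟩ := hp
  exact mem_seenSet.2 (hs p hp)

theorem dom_computable {M : List Bool →. List Bool} (hM : Partrec M) (hpf : PrefixFreeDom M)
    (hcomp : IsComputableReal (chaitinOmega M)) :
    ∃ D : List Bool → Bool, Computable D ∧ ∀ p, D p = true ↔ (M p).Dom := by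
  obtain ⟨f, hf, happ⟩ := hcomp
  obtain ⟨hnum, hden⟩ := computable_num_den hf
  obtain ⟨c, hc⟩ := exists_halting_code M hM
  have hΩ : 0 ≤ chaitinOmega M := tsum_nonneg fun p => by positivity
  have hdom : ∀ s, ∀ p ∈ seenSet c s, (M p).Dom :=
    fun s p hp => (hc p).1 (seen_dom (mem_seenSet.1 hp))
  -- the stopping condition
  let cond : ℕ → ℕ → Bool := fun n s =>
    decide ((f (n + 1)).num.toNat * (2 ^ (n + 1) * 2 ^ s) <
      (f (n + 1)).den * (stageSum c s * 2 ^ (n + 1) + 2 ^ s))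
  have hcond : Computable₂ cond := by
    have hn : Computable fun x : ℕ × ℕ => x.1 + 1 := Computable.succ.comp Computable.fst
    have hpn : Computable fun x : ℕ × ℕ => 2 ^ (x.1 + 1) := primrec_two_pow.to_comp.comp hn
    have hps : Computable fun x : ℕ × ℕ => 2 ^ x.2 := primrec_two_pow.to_comp.comp Computable.snd
    have hst : Computable fun x : ℕ × ℕ => stageSum c x.2 :=
      (primrec_stageSum c).to_comp.comp Computable.snd
    have hmul := Primrec.nat_mul.to_comp
    have hadd := Primrec.nat_add.to_comp
    have hlt : Computable₂ fun a b : ℕ => decide (a < b) := Primrec.nat_lt.decide.to_comp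
    exact hlt.comp (hmul.comp (hnum.comp hn) (hmul.comp hpn hps))
      (hmul.comp (hden.comp hn) (hadd.comp (hmul.comp hst hpn) hps))
  have hcond_iff : ∀ n s, cond n s = true ↔
      (((f (n + 1)).num.toNat : ℝ) / (f (n + 1)).den - (2 : ℝ) ^ (-((n + 1 : ℕ) : ℤ)) <
        ∑ p ∈ seenSet c s, (2 : ℝ) ^ (-(p.length : ℤ))) := by
    intro n s
    rw [← stageSum_eq, zpow_neg, zpow_natCast]
    have hd : (0 : ℝ) < (f (n + 1)).den := by exact_mod_cast (f (n + 1)).den_pos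
    simp only [cond, decide_eq_true_eq]
    rw [sub_lt_iff_lt_add, ← one_div, div_add_div _ _ (by positivity) (by positivity),
      div_lt_div_iff₀ hd (by positivity), ← Nat.cast_lt (α := ℝ)]
    push_cast
    constructor <;> intro h <;> linarith
  have hq : ∀ n : ℕ, chaitinOmega M - (2 : ℝ) ^ (-(n : ℤ)) < ((f n).num.toNat : ℝ) / (f n).den ∧
      ((f n).num.toNat : ℝ) / (f n).den - (2 : ℝ) ^ (-(n : ℤ)) < chaitinOmega M := by
    intro n
    have h1 := abs_lt.1 (happ n)
    have hd : (0 : ℝ) < (f n).den := by exact_mod_cast (f n).den_pos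
    have hp : (0 : ℝ) < (2 : ℝ) ^ (-(n : ℤ)) := by positivity
    rw [Rat.cast_def] at h1
    rcases le_total 0 (f n).num with hs | hs
    · have : ((f n).num.toNat : ℝ) = ((f n).num : ℝ) := by exact_mod_cast Int.toNat_of_nonneg hs
      rw [this]
      constructor <;> linarith
    · have h0 : (f n).num.toNat = 0 := Int.toNat_of_nonpos hs
      have : ((f n).num : ℝ) / (f n).den ≤ 0 :=
        div_nonpos_of_nonpos_of_nonneg (by exact_mod_cast hs) hd.le
      rw [h0]
      simp only [Nat.cast_zero, zero_div]
      constructor <;> linarith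
  obtain ⟨g, hg, hg'⟩ := exists_computable_find hcond (fun n => by
    obtain ⟨s, hs⟩ := exists_stage_gt hpf hc (hq (n + 1)).2
    exact ⟨s, (hcond_iff n s).2 hs⟩)
  refine ⟨fun p => seen c (g p.length) p, ?_, fun p => ⟨fun h => (hc p).1 (seen_dom h), fun h => ?_⟩⟩
  · exact (primrec_seen c).to_comp.comp (hg.comp Primrec.list_length.to_comp) Computable.id
  · by_contra hns
    have hnot : p ∉ seenSet c (g p.length) := fun hm => hns (mem_seenSet.1 hm)
    have h1 := (hcond_iff _ _).1 (hg' p.length).1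
    have h2 := sum_le_omega hpf (insert p (seenSet c (g p.length))) (by
      intro q hq
      rcases Finset.mem_insert.1 hq with rfl | hq
      · exact h
      · exact hdom _ q hq)
    rw [Finset.sum_insert hnot] at h2
    have h3 := (hq (p.length + 1)).1
    have h4 : (2 : ℝ) ^ (-(p.length : ℤ)) = 2 * (2 : ℝ) ^ (-((p.length + 1 : ℕ) : ℤ)) := by
      rw [zpow_neg, zpow_neg, zpow_natCast, zpow_natCast, pow_succ]
      field_simp
    linarith

/-- The string `1^k 0`. -/
def unary (k : ℕ) : List Bool := (List.range k).map (fun _ => true) ++ [false]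

theorem primrec_unary : Primrec unary :=
  Primrec.list_append.comp (Primrec.list_map Primrec.list_range (Primrec.const true).to₂)
    (Primrec.const [false])

theorem unary_length (k : ℕ) : (unary k).length = k + 1 := by simp [unary]

theorem unary_prefix {j k : ℕ} (h : unary j <+: unary k) : j = k := by
  have hl := h.length_le
  rw [unary_length, unary_length] at hl
  by_contra hne
  have hlt : j < k := by omega
  have h1 : (unary j)[j]? = some false := by simp [unary]
  have h2 : (unary k)[j]? = some true := by
    simp [unary, List.getElem?_append, hlt]
  obtain ⟨t, ht⟩ := h
  rw [← ht, List.getElem?_append_left (by rw [unary_length]; omega), h1] at h2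
  simp at h2

open Nat.Partrec in
/-- A prefix-free machine encoding the halting problem. -/
def haltMachine : List Bool →. List Bool := fun p =>
  bif decide (p = unary (p.length - 1)) then
    ((Denumerable.ofNat Code (p.length - 1)).eval 0).map fun _ => []
  else Part.none

theorem haltMachine_partrec : Partrec haltMachine := by
  have hl : Primrec fun p : List Bool => p.length - 1 :=
    Primrec.pred.comp Primrec.list_length
  refine Partrec.cond ?_ ?_ Partrec.none
  · exact (Primrec.eq.comp Primrec.id (primrec_unary.comp hl)).decide.to_comp
  · refine Partrec.map ?_ (Computable.const []).to₂
    exact Nat.Partrec.Code.eval_part.comp ((Primrec.ofNat _).comp hl).to_comp (Computable.const 0)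

theorem haltMachine_dom {p : List Bool} (h : (haltMachine p).Dom) : ∃ k, p = unary k := by
  by_cases hp : p = unary (p.length - 1)
  · exact ⟨_, hp⟩
  · simp [haltMachine, hp] at h

theorem haltMachine_unary (c : Nat.Partrec.Code) :
    (haltMachine (unary (Encodable.encode c))).Dom ↔ (c.eval 0).Dom := by
  simp [haltMachine, unary_length]

theorem chaitinOmega_not_computable (M : List Bool →. List Bool)
    (hM : Partrec M) (hpf : PrefixFreeDom M) (huniv : UniversalPF M) :
    ¬ IsComputableReal (chaitinOmega M) := by
  intro hcomp
  obtain ⟨D, hD, hD'⟩ := dom_computable hM hpf hcomp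
  obtain ⟨w, hw⟩ := huniv haltMachine haltMachine_partrec (by
    intro p q hp hq hpq
    obtain ⟨j, rfl⟩ := haltMachine_dom hp
    obtain ⟨k, rfl⟩ := haltMachine_dom hq
    rw [unary_prefix hpq])
  refine ComputablePred.halting_problem 0 ⟨Classical.decPred _, ?_⟩
  have h1 : Computable fun c : Nat.Partrec.Code => D (w ++ unary (Encodable.encode c)) :=
    hD.comp (Primrec.list_append.comp (Primrec.const w)
      (primrec_unary.comp Primrec.encode)).to_comp
  refine h1.of_eq fun c => ?_
  rw [Bool.eq_iff_iff, hD', hw, haltMachine_unary]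
  exact (@decide_eq_true_iff _ (_)).symm
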